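/- If L is a Fregean logic with a protoconjunction ∧, then the parametrized equational translation τ(x,y) := {x ∧ y ≈ y} almost defines truth in Mod* L. -/

import Mathlib

universe u

/-- An algebraic type (signature): a set of function symbols with finite arities. -/
structure AlgSig : Type (u + 1) where
  F : Type u
  ar : F → ℕ

/-- Terms (formulas) over a signature, with a countably infinite set `ℕ` of variables. -/
inductive Trm (S : AlgSig.{u}) : Type u
  | var : ℕ → Trm S
  | app : (f : S.F) → (Fin (S.ar f) → Trm S) → Trm S

/-- An algebra of a given signature. -/
structure AlgStr (S : AlgSig.{u}) : Type (u + 1) where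
  α : Type u
  op : (f : S.F) → (Fin (S.ar f) → α) → α

variable {S : AlgSig.{u}}

/-- Evaluation of a term in an algebra under a valuation (equivalently, the unique
homomorphism from the term algebra determined by the valuation). -/
def Trm.eval (A : AlgStr S) (v : ℕ → A.α) : Trm S → A.α
  | .var n => v n
  | .app f t => A.op f fun i => Trm.eval A v (t i)

/-- Substitution (an endomorphism of the term algebra). -/
def Trm.subst (σ : ℕ → Trm S) : Trm S → Trm S
  | .var n => σ n
  | .app f t => .app f fun i => Trm.subst σ (t i)

/-- All variables occurring in the term are `< n`. -/
def Trm.varsLT (n : ℕ) : Trm S → Prop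
  | .var m => m < n
  | .app _ t => ∀ i, Trm.varsLT n (t i)

/-- The absolutely free term algebra `Fm`. -/
def TrmAlg (S : AlgSig.{u}) : AlgStr S :=
  ⟨Trm S, Trm.app⟩

/-- A congruence of an algebra. -/
def IsCong (A : AlgStr S) (θ : A.α → A.α → Prop) : Prop :=
  Equivalence θ ∧
    ∀ (f : S.F) (x y : Fin (S.ar f) → A.α), (∀ i, θ (x i) (y i)) → θ (A.op f x) (A.op f y)

/-- A relation is compatible with a subset `F`. -/
def CompatWith {β : Type u} (θ : β → β → Prop) (F : Set β) : Prop :=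
  ∀ a b, θ a b → a ∈ F → b ∈ F

/-- The Leibniz congruence `Ω^A F`: the largest congruence of `A` compatible with `F`
(the union of all congruences compatible with `F`). -/
def Leibniz (A : AlgStr S) (F : Set A.α) : A.α → A.α → Prop :=
  fun a b => ∃ θ, IsCong A θ ∧ CompatWith θ F ∧ θ a b

/-- A matrix `⟨A, F⟩` is reduced if its Leibniz congruence is the identity relation. -/
def IsReducedMatrix (A : AlgStr S) (F : Set A.α) : Prop :=
  ∀ a b, Leibniz A F a b ↔ a = b

/-- A logic: a structural closure operator on sets of formulas. -/
structure Logic (S : AlgSig.{u}) where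
  C : Set (Trm S) → Set (Trm S)
  monotone : ∀ ⦃Γ Δ : Set (Trm S)⦄, Γ ⊆ Δ → C Γ ⊆ C Δ
  extensive : ∀ Γ, Γ ⊆ C Γ
  idem : ∀ Γ, C (C Γ) ⊆ C Γ
  structural : ∀ (σ : ℕ → Trm S) (Γ : Set (Trm S)),
    Trm.subst σ '' C Γ ⊆ C (Trm.subst σ '' Γ)

/-- Deductive filter of a logic over an algebra. -/
def IsDedFilter (Lo : Logic S) (A : AlgStr S) (Fl : Set A.α) : Prop :=
  ∀ (Γ : Set (Trm S)) (φ : Trm S), φ ∈ Lo.C Γ →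
    ∀ v : ℕ → A.α, (∀ γ ∈ Γ, Trm.eval A v γ ∈ Fl) → Trm.eval A v φ ∈ Fl

/-- Theories of a logic: the deductive filters over the term algebra. -/
def Theories (Lo : Logic S) : Set (Set (Trm S)) :=
  {Γ | IsDedFilter Lo (TrmAlg S) Γ}

/-- The deductive filter generated by a set. -/
def FgFilter (Lo : Logic S) (A : AlgStr S) (X : Set A.α) : Set A.α :=
  {a | ∀ G, IsDedFilter Lo A G → X ⊆ G → a ∈ G}

/-- The Suszko congruence of `F` relative to a logic: the intersection of the Leibniz
congruences of all deductive filters extending `F`. -/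
def Suszko (Lo : Logic S) (A : AlgStr S) (F : Set A.α) : A.α → A.α → Prop :=
  fun a b => ∀ G, IsDedFilter Lo A G → F ⊆ G → Leibniz A G a b

/-- Unary polynomial functions of an algebra. -/
def IsUnaryPoly (A : AlgStr S) (p : A.α → A.α) : Prop :=
  ∃ (φ : Trm S) (v : ℕ → A.α), ∀ a, p a = Trm.eval A (Function.update v 0 a) φ

/-- The set of solutions `τ(A)` of a parametrized equational translation `τ(x, ȳ)`,
where the distinguished variable `x` is variable `0` and the parameters are bound by a
universal quantifier. -/
def solSet (A : AlgStr S) (τ : Set (Trm S × Trm S)) : Set A.α :=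
  {a | ∀ (v : ℕ → A.α), ∀ e ∈ τ,
    Trm.eval A (Function.update v 0 a) e.1 = Trm.eval A (Function.update v 0 a) e.2}

/-- `τ` defines truth in `Mod* L`. -/
def DefinesTruth (Lo : Logic S) (τ : Set (Trm S × Trm S)) : Prop :=
  ∀ (A : AlgStr S) (F : Set A.α), IsDedFilter Lo A F → IsReducedMatrix A F →
    solSet A τ = F

/-- `τ` almost defines truth in `Mod* L` (i.e. on its non-almost-trivial members). -/
def AlmostDefinesTruth (Lo : Logic S) (τ : Set (Trm S × Trm S)) : Prop :=
  ∀ (A : AlgStr S) (F : Set A.α), IsDedFilter Lo A F → IsReducedMatrix A F →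
    F.Nonempty → solSet A τ = F

/-- Only the distinguished variable `x` (variable `0`) occurs: no parameters. -/
def Trm.noParams : Trm S → Prop
  | .var n => n = 0
  | .app _ t => ∀ i, Trm.noParams (t i)

/-- An equational translation: a set of equations in the single variable `x`. -/
def IsEqTranslation (τ : Set (Trm S × Trm S)) : Prop :=
  ∀ e ∈ τ, Trm.noParams e.1 ∧ Trm.noParams e.2

/-- The quotient of an algebra by a relation (intended: by a congruence). -/
noncomputable def quotAlg (A : AlgStr S) (r : A.α → A.α → Prop) : AlgStr S :=
  ⟨Quot r, fun f x => Quot.mk r (A.op f fun i => (x i).out)⟩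
variable {S : AlgSig.{u}}

/-- Homomorphisms between algebras of the same signature. -/
structure AlgHomS (A B : AlgStr S) where
  toFun : A.α → B.α
  map_op : ∀ (f : S.F) (x : Fin (S.ar f) → A.α),
    toFun (A.op f x) = B.op f fun i => toFun (x i)

/-- The Leibniz operator is completely order-reflecting on a family `X` of subsets. -/
def ComplOrderReflOn (A : AlgStr S) (X : Set (Set A.α)) : Prop :=
  ∀ (Fam : Set (Set A.α)) (G : Set A.α), Fam ⊆ X → G ∈ X →
    (∀ a b, (∀ F ∈ Fam, Leibniz A F a b) → Leibniz A G a b) → ⋂₀ Fam ⊆ G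

/-- A Fregean logic: every Frege relation `Λ_L Γ` is a congruence of the term algebra. -/
def Fregean (Lo : Logic S) : Prop :=
  ∀ Γ : Set (Trm S),
    IsCong (TrmAlg S) fun φ ψ => ψ ∈ Lo.C (Γ ∪ {φ}) ∧ φ ∈ Lo.C (Γ ∪ {ψ})

/-- A protoalgebraic logic: there is a set `Δ(x,y)` of formulas in two variables with
`∅ ⊢ Δ(x,x)` and `{x} ∪ Δ(x,y) ⊢ y`. -/
def Protoalgebraic (Lo : Logic S) : Prop :=
  ∃ Δ : Set (Trm S), (∀ d ∈ Δ, Trm.varsLT 2 d) ∧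
    (∀ d ∈ Δ, Trm.subst (fun _ => Trm.var 0) d ∈ Lo.C ∅) ∧
    Trm.var 1 ∈ Lo.C ({Trm.var 0} ∪ Δ)

/-- The binary term `a ∧ b` built from a binary function symbol `m`. -/
def binT (m : S.F) (hm : S.ar m = 2) (a b : Trm S) : Trm S :=
  Trm.app m fun i => ![a, b] (Fin.cast hm i)

/-- The binary operation of an algebra induced by a binary function symbol `m`. -/
def binA (A : AlgStr S) (m : S.F) (hm : S.ar m = 2) (a b : A.α) : A.α :=
  A.op m fun i => ![a, b] (Fin.cast hm i)

/-- A subuniverse (universe of a subalgebra). -/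
def Subuniv (A : AlgStr S) (B : Set A.α) : Prop :=
  ∀ (f : S.F) (x : Fin (S.ar f) → A.α), (∀ i, x i ∈ B) → A.op f x ∈ B

/-- The subuniverse generated by a set. -/
def Sg (A : AlgStr S) (X : Set A.α) : Set A.α :=
  ⋂₀ {B | Subuniv A B ∧ X ⊆ B}

/-- A subuniverse is `κ`-generated if it is generated by a subset of cardinality `≤ κ`. -/
def KGenerated (A : AlgStr S) (κ : Cardinal.{u}) (B : Set A.α) : Prop :=
  ∃ X : Set A.α, Cardinal.mk X ≤ κ ∧ Sg A X = B

/-- The subalgebra with universe a given subuniverse. -/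
def subAlg (A : AlgStr S) (B : Set A.α) (hB : Subuniv A B) : AlgStr S :=
  ⟨B, fun f x => ⟨A.op f fun i => (x i).1, hB f _ fun i => (x i).2⟩⟩

/-- The signature expanded with a single new constant symbol `1`. -/
def expSig (S : AlgSig.{u}) : AlgSig.{u} :=
  ⟨S.F ⊕ PUnit, Sum.elim S.ar fun _ => 0⟩

/-- The inclusion of the original terms into the terms of the expanded signature. -/
def Trm.incl : Trm S → Trm (expSig S)
  | .var n => .var n
  | .app f t => .app (Sum.inl f) fun i => Trm.incl (t i)

theorem eval_subst' {S : AlgSig.{u}} (A : AlgStr S) (v : ℕ → A.α) (σ : ℕ → Trm S) (t : Trm S) :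
    Trm.eval A v (Trm.subst σ t) = Trm.eval A (fun n => Trm.eval A v (σ n)) t := by
  induction t with
  | var n => rfl
  | app f t ih => simp only [Trm.subst, Trm.eval, ih]

theorem eval_congr' {S : AlgSig.{u}} (A : AlgStr S) (v w : ℕ → A.α) (k : ℕ)
    (h : ∀ n < k, v n = w n) (t : Trm S) (ht : Trm.varsLT k t) :
    Trm.eval A v t = Trm.eval A w t := by
  induction t with
  | var n => exact h n ht
  | app f t ih =>
    simp only [Trm.eval]
    congr 1
    funext i
    exact ih i (ht i)

/-- Interchangeability in all polynomial contexts. -/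
def PolyEq {S : AlgSig.{u}} (A : AlgStr S) (F : Set A.α) (a b : A.α) : Prop :=
  ∀ (φ : Trm S) (v : ℕ → A.α) (n : ℕ),
    Trm.eval A (Function.update v n a) φ ∈ F ↔ Trm.eval A (Function.update v n b) φ ∈ F

theorem polyEq_multi {S : AlgSig.{u}} (A : AlgStr S) (F : Set A.α) (ψ : Trm S) (N : ℕ)
    (v w : ℕ → A.α) (h : ∀ n < N, PolyEq A F (v n) (w n)) (k : ℕ) (hk : k ≤ N) :
    Trm.eval A v ψ ∈ F ↔ Trm.eval A (fun n => if n < k then w n else v n) ψ ∈ F := by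
  induction k with
  | zero => simp
  | succ k ih =>
    rw [ih (by omega)]
    have := h k (by omega) ψ (fun n => if n < k then w n else v n) k
    convert this using 3
    · funext n
      by_cases hn : n = k
      · subst hn; simp
      · simp [Function.update_of_ne hn]
    · funext n
      by_cases hn : n = k
      · subst hn; simp
      · have : n < k + 1 ↔ n < k := by omega
        simp [Function.update_of_ne hn, this]

theorem polyEq_cong {S : AlgSig.{u}} (A : AlgStr S) (F : Set A.α) : IsCong A (PolyEq A F) := by
  refine ⟨⟨fun _ _ _ _ => Iff.rfl, fun h φ v n => (h φ v n).symm,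
    fun h h' φ v n => (h φ v n).trans (h' φ v n)⟩, ?_⟩
  intro f x y hxy φ v n
  let N := S.ar f
  let σ : ℕ → Trm S := fun m => if m = n then Trm.app f (fun i => Trm.var i.1) else Trm.var (m + N)
  let V : (Fin N → A.α) → ℕ → A.α := fun z m => if hm : m < N then z ⟨m, hm⟩ else v (m - N)
  have key : ∀ z : Fin N → A.α, Trm.eval A (Function.update v n (A.op f z)) φ
      = Trm.eval A (V z) (Trm.subst σ φ) := by
    intro z
    rw [eval_subst']
    congr 1
    funext m
    by_cases hm : m = n
    · subst hm
      simp [σ, Trm.eval, V, N]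
    · simp [Function.update_of_ne hm, σ, hm, Trm.eval, V]
  rw [key, key]
  rw [polyEq_multi A F _ N (V x) (V y) (fun m hm => by simpa [V, hm] using hxy ⟨m, hm⟩) N le_rfl]
  have : (fun m => if m < N then V y m else V x m) = V y := by
    funext m
    by_cases hm : m < N <;> simp [V, hm]
  rw [this]

theorem polyEq_leibniz {S : AlgSig.{u}} (A : AlgStr S) (F : Set A.α) (a b : A.α)
    (h : PolyEq A F a b) : Leibniz A F a b := by
  refine ⟨PolyEq A F, polyEq_cong A F, ?_, h⟩
  intro a b hab ha
  have := hab (Trm.var 0) (fun _ => a) 0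
  simp only [Trm.eval, Function.update_self] at this
  exact this.1 ha

theorem cong_subst {S : AlgSig.{u}} (θ : Trm S → Trm S → Prop) (h : IsCong (TrmAlg S) θ)
    (σ ρ : ℕ → Trm S) (hs : ∀ n, θ (σ n) (ρ n)) (φ : Trm S) :
    θ (Trm.subst σ φ) (Trm.subst ρ φ) := by
  induction φ with
  | var n => exact hs n
  | app f t ih => exact h.2 f _ _ ih

/-- if `L` is Fregean with a protoconjunction `∧` (a binary term `c`
with `{x,y} ⊢ x ∧ y`, `{x, x ∧ y} ⊢ y` and `{y, x ∧ y} ⊢ x`), then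
`τ(x,y) := {x ∧ y ≈ y}` almost defines truth in `Mod* L`. -/
theorem fregean_protoconjunction {S : AlgSig.{u}} (Lo : Logic S) (hFr : Fregean Lo)
    (c : Trm S) (hc : Trm.varsLT 2 c)
    (h1 : c ∈ Lo.C {Trm.var 0, Trm.var 1})
    (h2 : Trm.var 1 ∈ Lo.C {Trm.var 0, c})
    (h3 : Trm.var 0 ∈ Lo.C {Trm.var 1, c}) :
    AlmostDefinesTruth Lo {(c, Trm.var 1)} := by
  intro A F hF hR hne
  ext a
  constructor
  · intro ha
    obtain ⟨b, hb⟩ := hne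
    have e := ha (fun _ => b) (c, Trm.var 1) rfl
    simp only [Trm.eval] at e
    have := hF _ _ h3 (Function.update (fun _ => b) 0 a) (by
      intro γ hγ
      rcases hγ with rfl | rfl
      · simpa [Trm.eval] using hb
      · rw [e]; simpa using hb)
    simpa [Trm.eval] using this
  · intro ha v e he
    obtain rfl : e = (c, Trm.var 1) := he
    refine (hR _ _).1 (polyEq_leibniz A F _ _ ?_)
    intro φ v' n
    let b := v 1
    let V : ℕ → A.α := fun m => if m = 0 then a else if m = 1 then b else v' (m - 2)
    let σ : Trm S → ℕ → Trm S := fun t m => if m = n then t else Trm.var (m + 2)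
    have key : ∀ t : Trm S, Trm.eval A (Function.update v' n (Trm.eval A V t)) φ
        = Trm.eval A V (Trm.subst (σ t) φ) := by
      intro t
      rw [eval_subst']
      congr 1
      funext m
      by_cases hm : m = n
      · subst hm
        simp [σ]
      · simp [Function.update_of_ne hm, σ, hm, Trm.eval, V]
    have hV : ∀ t : Trm S, Trm.varsLT 2 t →
        Trm.eval A (Function.update v 0 a) t = Trm.eval A V t := by
      intro t ht
      refine eval_congr' A _ _ 2 ?_ t ht
      intro m hm
      interval_cases m <;> simp [V, b]
    have hcong := hFr {Trm.var 0}
    have hrel := cong_subst _ hcong (σ c) (σ (Trm.var 1)) (by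
      intro m
      by_cases hm : m = n
      · simp only [σ, hm, if_true]
        exact ⟨h2, h1⟩
      · simp only [σ, hm, if_false]
        exact hcong.1.refl _) φ
    have hVa : Trm.eval A V (Trm.var 0) ∈ F := by simpa [Trm.eval, V] using ha
    rw [hV c hc, hV (Trm.var 1) (by simp [Trm.varsLT]), key, key]
    constructor
    · intro h
      refine hF _ _ hrel.1 V ?_
      rintro γ (rfl | rfl)
      · exact hVa
      · exact h
    · intro h
      refine hF _ _ hrel.2 V ?_
      rintro γ (rfl | rfl)
      · exact hVa
      · exact h
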